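/- The functor Ex preserves Kan fibrations and trivial fibrations: if p : X → Y is a Kan fibration of simplicial sets then Ex p : Ex X → Ex Y is a Kan fibration, and if p is a trivial fibration then Ex p is a trivial fibration. -/

import Mathlib

open CategoryTheory CategoryTheory.Limits Simplicial MonoidalCategory SSet

noncomputable instance : MonoidalClosed SSet.{0} :=
  (inferInstance : MonoidalClosed (SimplexCategoryᵒᵖ ⥤ Type 0))

namespace Paper

/-- A map of simplicial sets is a *trivial fibration* if it has the right lifting
property with respect to all boundary inclusions `∂Δ[n] ⟶ Δ[n]` for `n ≥ 0`. -/
def TrivialFibration {X Y : SSet.{0}} (p : X ⟶ Y) : Prop :=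
  ∀ n : ℕ, HasLiftingProperty (SSet.boundary n).ι p

/-- A map of simplicial sets is a *Kan fibration* if it has the right lifting property
with respect to all horn inclusions `Λ[n, i] ⟶ Δ[n]` for `n ≥ 1`, `0 ≤ i ≤ n`. -/
def KanFibration {X Y : SSet.{0}} (p : X ⟶ Y) : Prop :=
  ∀ (n : ℕ) (i : Fin (n + 2)), HasLiftingProperty (SSet.horn (n + 1) i).ι p

/-- An *anodyne* map is one with the left lifting property with respect to
all Kan fibrations. -/
def Anodyne {A B : SSet.{0}} (i : A ⟶ B) : Prop :=
  ∀ ⦃X Y : SSet.{0}⦄ (p : X ⟶ Y), KanFibration p → HasLiftingProperty i p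

/-- The unique map to `Δ[0]`. -/
def toPt (X : SSet.{0}) : X ⟶ Δ[0] where
  app m := ↾fun _ => SSet.stdSimplex.const 0 0 m
  naturality := by
    intro m m' φ
    apply ConcreteCategory.hom_ext
    intro x
    apply stdSimplex.objEquiv.injective
    apply SimplexCategory.Hom.ext
    apply OrderHom.ext
    funext j
    exact @Subsingleton.elim (Fin 1) _ _ _

/-- A *Kan complex* is a simplicial set whose map to `Δ[0]` is a Kan fibration. -/
def KanComplex (X : SSet.{0}) : Prop :=
  KanFibration (toPt X)

/-- The constant map at the vertex `k` of `Δ[1]`. -/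
def cst (X : SSet.{0}) (k : Fin 2) : X ⟶ Δ[1] where
  app m := ↾fun _ => SSet.stdSimplex.const 1 k m
  naturality := by
    intro m m' φ
    apply ConcreteCategory.hom_ext
    intro x
    apply stdSimplex.objEquiv.injective
    apply SimplexCategory.Hom.ext
    ext j
    rfl

/-- The endpoint inclusion `X ⟶ X ⊗ Δ[1]` at the vertex `k` of `Δ[1]`. -/
noncomputable def ept (X : SSet.{0}) (k : Fin 2) : X ⟶ X ⊗ Δ[1] :=
  CartesianMonoidalCategory.lift (𝟙 X) (cst X k)

/-- A (single-step) homotopy from `f` to `g`, as a property of the pair `(f, g)`. -/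
def Homotopy {X Y : SSet.{0}} (f g : X ⟶ Y) : Prop :=
  ∃ H : X ⊗ Δ[1] ⟶ Y, ept X 0 ≫ H = f ∧ ept X 1 ≫ H = g

/-- `f` and `g` are *homotopic* if they are connected by a zig-zag of homotopies. -/
def Homotopic {X Y : SSet.{0}} (f g : X ⟶ Y) : Prop :=
  Relation.EqvGen Homotopy f g

/-- A *homotopy equivalence* of simplicial sets. -/
def HomotopyEquivalence {X Y : SSet.{0}} (f : X ⟶ Y) : Prop :=
  ∃ g : Y ⟶ X, Homotopic (f ≫ g) (𝟙 X) ∧ Homotopic (g ≫ f) (𝟙 Y)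

/-- A map `f : X ⟶ Y` is a *weak homotopy equivalence* if for every Kan complex `K`
the induced map `K^Y ⟶ K^X` on exponentials is a homotopy equivalence. -/
def WeakHomotopyEquivalence {X Y : SSet.{0}} (f : X ⟶ Y) : Prop :=
  ∀ K : SSet.{0}, KanComplex K → HomotopyEquivalence ((MonoidalClosed.pre f).app K)

/-- A homotopy `H` between maps over `B` which is *fiberwise over `B`*. -/
def FibHomotopy {B X Y : SSet.{0}} (pX : X ⟶ B) (pY : Y ⟶ B) (f g : X ⟶ Y) : Prop :=
  ∃ H : X ⊗ Δ[1] ⟶ Y, ept X 0 ≫ H = f ∧ ept X 1 ≫ H = g ∧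
    H ≫ pY = CartesianMonoidalCategory.fst X Δ[1] ≫ pX

/-- Connectedness by a zig-zag of fiberwise homotopies over `B`. -/
def FibHomotopic {B X Y : SSet.{0}} (pX : X ⟶ B) (pY : Y ⟶ B) (f g : X ⟶ Y) : Prop :=
  Relation.EqvGen (FibHomotopy pX pY) f g

/-- A *fiberwise homotopy equivalence over `B`*. -/
def FibHomotopyEquivalence {B X Y : SSet.{0}} (pX : X ⟶ B) (pY : Y ⟶ B) (f : X ⟶ Y) : Prop :=
  f ≫ pY = pX ∧ ∃ g : Y ⟶ X, g ≫ pX = pY ∧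
    FibHomotopic pX pX (f ≫ g) (𝟙 X) ∧ FibHomotopic pY pY (g ≫ f) (𝟙 Y)

end Paper

namespace Paper

/-- The barycentric subdivision poset `sd [m]` of nonempty subsets of `[m]`,
ordered by inclusion. -/
def sd (m : SimplexCategory) : Type :=
  {S : Finset (Fin (m.len + 1)) // S.Nonempty}

instance (m : SimplexCategory) : PartialOrder (sd m) :=
  inferInstanceAs (PartialOrder {S : Finset (Fin (m.len + 1)) // S.Nonempty})

/-- The action of a simplicial operator on the subdivision posets, by taking images. -/
def sdMap {m n : SimplexCategory} (f : m ⟶ n) : sd m →o sd n where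
  toFun S := ⟨S.1.image f.toOrderHom, S.2.image _⟩
  monotone' := fun S T h => Finset.image_subset_image h

/-- Barycentric subdivision of simplices, as a functor to `Cat`. -/
def sdFunctor : SimplexCategory ⥤ Cat.{0, 0} where
  obj m := Cat.of (sd m)
  map f := (sdMap f).monotone.functor.toCatHom
  map_id m := by
    have hobj : ∀ S : sd m, (sdMap (𝟙 m)).monotone.functor.obj S = S := by
      intro S
      apply Subtype.ext
      exact Finset.image_id
    apply Cat.Hom.ext
    apply CategoryTheory.Functor.ext hobj
  map_comp {a b c} f g := by
    have hobj : ∀ S : sd a, (sdMap (f ≫ g)).monotone.functor.obj S =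
        ((sdMap f).monotone.functor ⋙ (sdMap g).monotone.functor).obj S := by
      intro S
      apply Subtype.ext
      exact (Finset.image_image (s := S.1) (f := f.toOrderHom) (g := g.toOrderHom)).symm
    apply Cat.Hom.ext
    apply CategoryTheory.Functor.ext hobj

/-- `Sd Δ[m] = N(sd [m])`, functorially in `[m]`. -/
def SdS : SimplexCategory ⥤ SSet.{0} := sdFunctor ⋙ nerveFunctor

/-- Kan's functor `Ex`, right adjoint to subdivision: `(Ex X)_m = Hom(Sd Δ[m], X)`. -/
def Ex : SSet.{0} ⥤ SSet.{0} where
  obj X := SdS.op ⋙ yoneda.obj X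
  map f := Functor.whiskerLeft SdS.op (yoneda.map f)

/-- The simplicial operator `[e] ⟶ [m]` taking `i` to the maximum of the `i`-th
subset in a chain of subsets of `[m]`. -/
def maxChain {m : SimplexCategory} {e : ℕ} (c : ComposableArrows (sd m) e) :
    (⦋e⦌ : SimplexCategory) ⟶ m :=
  SimplexCategory.Hom.mk
    { toFun := fun i => (c.obj i).1.max' (c.obj i).2
      monotone' := fun i j hij => Finset.max'_subset _ (leOfHom (c.map (homOfLE hij))) }

/-- The natural map `ν_X : X ⟶ Ex X`, adjoint transpose of `μ : Sd ⟶ id`. -/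
def nu (X : SSet.{0}) : X ⟶ Ex.obj X where
  app m := ↾fun x =>
    { app := fun k => ↾fun c => X.map (maxChain c).op x
      naturality := by
        intro k k' β
        apply ConcreteCategory.hom_ext
        intro c
        show X.map (maxChain (ComposableArrows.whiskerLeft c (SimplexCategory.toCat.map β.unop).toFunctor)).op x
          = X.map β (X.map (maxChain c).op x)
        rw [← FunctorToTypes.map_comp_apply]
        congr 1 }
  naturality := by
    intro m m' γ
    apply ConcreteCategory.hom_ext
    intro x
    apply NatTrans.ext
    funext k
    apply ConcreteCategory.hom_ext
    intro c
    show X.map (maxChain c).op (X.map γ x)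
      = X.map (maxChain ((SdS.map γ.unop).app k c)).op x
    have h : maxChain ((SdS.map γ.unop).app k c) = maxChain c ≫ γ.unop := by
      apply SimplexCategory.Hom.ext
      apply OrderHom.ext
      funext i
      apply le_antisymm
      · apply Finset.max'_le
        · exact (((SdS.map γ.unop).app k c).obj i).2
        intro y hy
        obtain ⟨a, ha, rfl⟩ := Finset.mem_image.mp hy
        exact γ.unop.toOrderHom.monotone
          (show a ≤ (c.obj i).1.max' (c.obj i).2 from Finset.le_max' _ _ ha)
      · apply Finset.le_max'
        exact Finset.mem_image_of_mem _ (Finset.max'_mem (c.obj i).1 (c.obj i).2)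
    rw [h, op_comp, FunctorToTypes.map_comp_apply]
    rfl

/-- The iterates `Ex^k X`. -/
def ExIter (X : SSet.{0}) : ℕ → SSet.{0} := fun n => match n with
  | 0 => X
  | (n + 1) => Ex.obj (ExIter X n)

/-- The sequence `X ⟶ Ex X ⟶ Ex² X ⟶ ⋯` given by `ν`. -/
def ExInftyDiagram (X : SSet.{0}) : ℕ ⥤ SSet.{0} :=
  Functor.ofSequence (fun n => nu (ExIter X n))

/-- `Ex^∞ X`, the colimit of `X ⟶ Ex X ⟶ Ex² X ⟶ ⋯`. -/
noncomputable def ExInfty (X : SSet.{0}) : SSet.{0} :=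
  colimit (ExInftyDiagram X)

/-- The canonical map `ν^∞ : X ⟶ Ex^∞ X`. -/
noncomputable def nuInfty (X : SSet.{0}) : X ⟶ ExInfty X :=
  colimit.ι (ExInftyDiagram X) 0

end Paper

namespace Paper

open Opposite HomotopicalAlgebra

lemma KanFibration.rlp_J {X Y : SSet.{0}} {p : X ⟶ Y} (hp : KanFibration p) :
    modelCategoryQuillen.J.rlp p := by
  intro A B i hi
  obtain ⟨n, ⟨k⟩⟩ := (MorphismProperty.iSup_iff _ _).1 hi
  exact hp n k

lemma TrivialFibration.rlp_monomorphisms {X Y : SSet.{0}} {p : X ⟶ Y}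
    (hp : TrivialFibration p) : (MorphismProperty.monomorphisms SSet.{0}).rlp p := by
  rw [SSet.rlp_monomorphisms]
  rintro _ _ _ ⟨n⟩
  exact hp n

/-- Homotopies can be lifted along a Kan fibration relative to a monomorphism and to one end
of the cylinder. -/
lemma KanFibration.exists_homotopy_lift {X Y : SSet.{0}} {p : X ⟶ Y} (hp : KanFibration p)
    {A B : SSet.{0}} (i : A ⟶ B) [Mono i] (k : Fin 2) (f : A ⊗ Δ[1] ⟶ X) (g : B ⊗ Δ[1] ⟶ Y)
    (hfg : f ≫ p = i ▷ _ ≫ g) (l : B ⟶ X)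
    (hf : A ◁ (horn 1 k).ι ≫ f = CartesianMonoidalCategory.fst _ _ ≫ i ≫ l)
    (hg : B ◁ (horn 1 k).ι ≫ g = CartesianMonoidalCategory.fst _ _ ≫ l ≫ p) :
    ∃ G : B ⊗ Δ[1] ⟶ X, i ▷ _ ≫ G = f ∧ G ≫ p = g := by
  let sq := Functor.PushoutObjObj.ofHasPushout (curriedTensor SSet.{0}) i (horn 1 k).ι
  have : HasLiftingProperty sq.ι p :=
    anodyneExtensions_pushoutObjObjι sq (anodyneExtensions.horn_ι k) _ hp.rlp_J
  have hl : sq.inl ≫ sq.ι = B ◁ (horn 1 k).ι := sq.inl_ι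
  have hr : sq.inr ≫ sq.ι = i ▷ _ := sq.inr_ι
  have sq' : CommSq (sq.isPushout.desc (CartesianMonoidalCategory.fst _ _ ≫ l) f
      (by rw [← Category.assoc]; exact hf.symm)) sq.ι p g := ⟨by
    apply sq.hom_ext
    · rw [IsPushout.inl_desc_assoc, reassoc_of% hl, hg, Category.assoc]
    · rw [IsPushout.inr_desc_assoc, reassoc_of% hr, hfg]⟩
  refine ⟨sq'.lift, ?_, sq'.fac_right⟩
  rw [← hr, Category.assoc, sq'.fac_left, IsPushout.inr_desc]

section

variable {P : Type} [Preorder P]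

/-- The endomorphism of the nerve of a preorder induced by a monotone map. -/
def nerveEnd (s : P →o P) : nerve P ⟶ nerve P := nerveMap s.monotone.functor

/-- The homotopy on the nerve of a preorder induced by a monotone map `P × {0 < 1} → P`. -/
def nerveHomotopy (h : P × Fin 2 →o P) : nerve P ⊗ Δ[1] ⟶ nerve P where
  app _ := ↾fun x ↦ Monotone.functor (f := fun j ↦ h (x.1.obj j, stdSimplex.asOrderHom x.2 j))
    fun _ _ hij ↦ h.monotone ⟨leOfHom (x.1.map (homOfLE hij)),
      (stdSimplex.asOrderHom x.2).monotone hij⟩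
  naturality _ _ _ := rfl

/-- The restriction of a homotopy to one end of the cylinder. -/
def atEnd (h : P × Fin 2 →o P) (k : Fin 2) : P →o P where
  toFun x := h (x, k)
  monotone' _ _ hxy := h.monotone ⟨hxy, le_rfl⟩

/-- The lifting problem `(a, b)` for the inclusion of `Q` in the nerve of `P` and for `p` has a
solution after precomposition with the monotone map `s`. -/
def HasLiftAlong {X Y : SSet.{0}} (p : X ⟶ Y) {Q : (nerve P).Subcomplex} (a : Q.toSSet ⟶ X)
    (b : nerve P ⟶ Y) (s : P →o P) : Prop :=
  ∃ l : nerve P ⟶ X, l ≫ p = nerveEnd s ≫ b ∧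
    ∀ (m : SimplexCategoryᵒᵖ) (c : (nerve P).obj m), c ∈ Q.obj m →
      ∃ hc : (nerveEnd s).app m c ∈ Q.obj m, l.app m c = a.app m ⟨_, hc⟩

lemma asOrderHom_of_mem_horn {k : Fin 2} {m : SimplexCategoryᵒᵖ} {z : (Δ[1] : SSet.{0}).obj m}
    (hz : z ∈ (horn 1 k).obj m) (j) : stdSimplex.asOrderHom z j = k := by
  rw [mem_horn_iff] at hz
  by_contra! hj
  refine hz (Set.eq_univ_of_forall fun x ↦ ?_)
  by_cases hx : x = k
  · exact Or.inr hx
  · exact Or.inl ⟨j, by omega⟩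

lemma HasLiftAlong.of_homotopy {X Y : SSet.{0}} {p : X ⟶ Y} (hp : KanFibration p)
    {Q : (nerve P).Subcomplex} {a : Q.toSSet ⟶ X} {b : nerve P ⟶ Y} (hab : a ≫ p = Q.ι ≫ b)
    (h : P × Fin 2 →o P)
    (hQ : ∀ (m : SimplexCategoryᵒᵖ) (x : (nerve P ⊗ Δ[1]).obj m), x.1 ∈ Q.obj m →
      (nerveHomotopy h).app m x ∈ Q.obj m) {k : Fin 2}
    (hk : HasLiftAlong p a b (atEnd h k)) (k' : Fin 2) : HasLiftAlong p a b (atEnd h k') := by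
  obtain ⟨l, hl, hl'⟩ := hk
  let hA : Q.toSSet ⊗ Δ[1] ⟶ Q.toSSet := Subcomplex.lift (Q.ι ▷ _ ≫ nerveHomotopy h) (by
    rintro m _ ⟨x, rfl⟩
    exact hQ m _ x.1.2)
  have hk (m : SimplexCategoryᵒᵖ) (c : (nerve P).obj m) (z : (Δ[1] : SSet.{0}).obj m)
      (hz : ∀ j, stdSimplex.asOrderHom z j = k) :
      (nerveHomotopy h).app m (c, z) = (nerveEnd (atEnd h k)).app m c := by
    apply nerve.ext_of_isThin
    funext j
    exact congrArg (fun t ↦ h (c.obj j, t)) (hz j)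
  obtain ⟨G, hG, hG'⟩ := hp.exists_homotopy_lift Q.ι k (hA ≫ a) (nerveHomotopy h ≫ b)
    (by rw [Category.assoc, hab]; rfl) l
    (by
      ext m x
      obtain ⟨hc, e⟩ := hl' m _ x.1.2
      refine Eq.trans ?_ e.symm
      exact congrArg (a.app m) (Subtype.ext (hk _ _ _ (asOrderHom_of_mem_horn x.2.2))))
    (by
      rw [hl]
      ext m x
      exact congrArg (b.app m) (hk _ _ _ (asOrderHom_of_mem_horn x.2.2)))
  refine ⟨ept (nerve P) k' ≫ G, by rw [Category.assoc, hG']; rfl, fun m c hc ↦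
    ⟨hQ m ((ept (nerve P) k').app m c) hc, ?_⟩⟩
  exact ConcreteCategory.congr_hom (NatTrans.congr_app hG m)
    ((⟨c, hc⟩, ((ept (nerve P) k').app m c).2) : (Q.toSSet ⊗ Δ[1]).obj m)

end

lemma exists_injective_hom_of_nonempty {n : SimplexCategory} (S : sd n) :
    ∃ (w : SimplexCategory) (e : w ⟶ n), Function.Injective e.toOrderHom ∧
      ∀ x, x ∈ S.1 ↔ ∃ y, e.toOrderHom y = x := by
  have hS : S.1.card = S.1.card - 1 + 1 := by have := S.2.card_pos; omega
  refine ⟨⦋S.1.card - 1⦌, SimplexCategory.Hom.mk (S.1.orderEmbOfFin hS).toOrderHom,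
    (S.1.orderEmbOfFin hS).injective, fun x ↦ ?_⟩
  have := Set.ext_iff.1 (S.1.range_orderEmbOfFin hS) x
  exact this.symm

/-- A chain of subsets contained in the range of a simplicial operator is the image of a chain. -/
lemma exists_SdS_map_eq {w n : SimplexCategory} (e : w ⟶ n) {k : SimplexCategoryᵒᵖ}
    (c : (nerve (sd n)).obj k) (hc : ∀ j, ∀ x ∈ (c.obj j).1, ∃ y, e.toOrderHom y = x) :
    ∃ r : (nerve (sd w)).obj k, (SdS.map e).app k r = c := by
  refine ⟨Monotone.functor (f := fun j ↦
    (⟨Finset.univ.filter fun y ↦ e.toOrderHom y ∈ (c.obj j).1, ?_⟩ : sd w)) ?_, ?_⟩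
  · obtain ⟨x, hx⟩ := (c.obj j).2
    obtain ⟨y, rfl⟩ := hc j x hx
    exact ⟨y, by simpa using hx⟩
  · intro i j hij y hy
    have := leOfHom (c.map (homOfLE hij))
    simp only [Finset.mem_filter, Finset.mem_univ, true_and] at hy ⊢
    exact this hy
  · refine nerve.ext_of_isThin (C := sd n) ?_
    funext j
    apply Subtype.ext
    ext x
    refine Finset.mem_image.trans ⟨?_, fun hx ↦ ?_⟩
    · rintro ⟨y, hy, rfl⟩
      exact (Finset.mem_filter.1 hy).2
    · obtain ⟨y, rfl⟩ := hc j x hx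
      exact ⟨y, Finset.mem_filter.2 ⟨Finset.mem_univ _, hx⟩, rfl⟩

lemma SdS_map_app_injective {w n : SimplexCategory} (e : w ⟶ n)
    (he : Function.Injective e.toOrderHom) (k : SimplexCategoryᵒᵖ) :
    Function.Injective ((SdS.map e).app k) := by
  intro (r : (nerve (sd w)).obj k) (r' : (nerve (sd w)).obj k) h
  apply nerve.ext_of_isThin
  funext j
  apply Subtype.ext
  apply Finset.image_injective he
  exact congrArg (fun c : (nerve (sd n)).obj k ↦ (c.obj j).1) h

lemma SdS_map_comp_app {l m n : SimplexCategory} (f : l ⟶ m) (g : m ⟶ n)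
    {k : SimplexCategoryᵒᵖ} (d : (nerve (sd l)).obj k) :
    (SdS.map (f ≫ g)).app k d = (SdS.map g).app k ((SdS.map f).app k d) := by
  rw [SdS.map_comp]; rfl

/-- The barycentric subdivision of a subcomplex of a standard simplex. -/
def sdSubcomplex {n : SimplexCategory} (K : (stdSimplex.{0}.obj n).Subcomplex) :
    (nerve (sd n)).Subcomplex where
  obj k := {c | ∃ (m : SimplexCategory) (σ : m ⟶ n), stdSimplex.objEquiv.symm σ ∈ K.obj (op m) ∧
    ∃ d : (nerve (sd m)).obj k, (SdS.map σ).app k d = c}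
  map β := by
    rintro _ ⟨m, σ, hσ, d, rfl⟩
    exact ⟨m, σ, hσ, (nerve (sd m)).map β d, rfl⟩

section

variable {n : SimplexCategory} {K : (stdSimplex.{0}.obj n).Subcomplex}

lemma comp_mem {l m : SimplexCategory} (f : l ⟶ m) {σ : m ⟶ n}
    (h : stdSimplex.objEquiv.symm σ ∈ K.obj (op m)) :
    stdSimplex.objEquiv.symm (f ≫ σ) ∈ K.obj (op l) :=
  K.map f.op h

variable {X : SSet.{0}} (u : K.toSSet ⟶ Ex.obj X)

/-- The value of a map to `Ex X` at a simplex, as a map out of a subdivided simplex. -/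
def exApp {m : SimplexCategory} (σ : m ⟶ n)
    (h : stdSimplex.objEquiv.symm σ ∈ K.obj (op m)) : nerve (sd m) ⟶ X :=
  u.app (op m) ⟨_, h⟩

lemma exApp_comp {l m : SimplexCategory} (f : l ⟶ m) (σ : m ⟶ n)
    (h : stdSimplex.objEquiv.symm σ ∈ K.obj (op m)) :
    exApp u (f ≫ σ) (comp_mem f h) = SdS.map f ≫ exApp u σ h :=
  ConcreteCategory.congr_hom (u.naturality f.op) ⟨_, h⟩

lemma exApp_comp_app {l m : SimplexCategory} (f : l ⟶ m) (σ : m ⟶ n)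
    (h : stdSimplex.objEquiv.symm σ ∈ K.obj (op m)) {k : SimplexCategoryᵒᵖ}
    (d : (nerve (sd l)).obj k) :
    (exApp u (f ≫ σ) (comp_mem f h)).app k d = (exApp u σ h).app k ((SdS.map f).app k d) := by
  rw [exApp_comp]; rfl

/-- The top element of a chain. -/
def top {k : SimplexCategoryᵒᵖ} (c : (nerve (sd n)).obj k) : sd n := c.obj (Fin.last _)

lemma le_top {k : SimplexCategoryᵒᵖ} (c : (nerve (sd n)).obj k) (j) : c.obj j ≤ top c :=
  leOfHom (c.map (homOfLE (Fin.le_last j)))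

/-- The value of `u` on a subdivided simplex can be computed on the face spanned by the top of
a chain. -/
lemma exApp_app_eq {w m : SimplexCategory} {σ : m ⟶ n}
    (h : stdSimplex.objEquiv.symm σ ∈ K.obj (op m)) {k : SimplexCategoryᵒᵖ}
    (d : (nerve (sd m)).obj k) (e : w ⟶ n) (he : Function.Injective e.toOrderHom)
    (he' : ∀ x, x ∈ (top ((SdS.map σ).app k d)).1 ↔ ∃ y, e.toOrderHom y = x)
    (r : (nerve (sd w)).obj k) (hr : (SdS.map e).app k r = (SdS.map σ).app k d) :
    ∃ hK : stdSimplex.objEquiv.symm e ∈ K.obj (op w),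
      (exApp u σ h).app k d = (exApp u e hK).app k r := by
  have hemono : StrictMono e.toOrderHom := e.toOrderHom.monotone.strictMono_of_injective he
  replace he' (x) : (∃ y, e.toOrderHom y = x) ↔ ∃ z ∈ (top d).1, σ.toOrderHom z = x :=
    (he' x).symm.trans Finset.mem_image
  obtain ⟨w', f, -, hf⟩ := exists_injective_hom_of_nonempty (top d)
  choose s hs using fun y ↦ (he' (e.toOrderHom y)).1 ⟨y, rfl⟩
  choose π hπ using fun z ↦ (he' (σ.toOrderHom (f.toOrderHom z))).2
    ⟨_, (hf _).2 ⟨z, rfl⟩, rfl⟩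
  have hs' : Monotone s := by
    apply StrictMono.monotone
    intro x y hxy
    by_contra! hle
    have := σ.toOrderHom.monotone hle
    rw [(hs x).2, (hs y).2] at this
    exact this.not_gt (hemono hxy)
  have hπ' : Monotone π := by
    intro x y hxy
    rw [← hemono.le_iff_le, hπ, hπ]
    exact σ.toOrderHom.monotone (f.toOrderHom.monotone hxy)
  let g : w ⟶ m := SimplexCategory.Hom.mk ⟨s, hs'⟩
  let q : w' ⟶ w := SimplexCategory.Hom.mk ⟨π, hπ'⟩
  have hg : g ≫ σ = e := by
    apply SimplexCategory.Hom.ext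
    ext y : 2
    exact (hs y).2
  have hq : q ≫ e = f ≫ σ := by
    apply SimplexCategory.Hom.ext
    ext y : 2
    exact hπ y
  have hK : stdSimplex.objEquiv.symm e ∈ K.obj (op w) := hg ▸ comp_mem g h
  obtain ⟨d', rfl⟩ := exists_SdS_map_eq f d fun j x hx ↦ (hf x).1 (le_top d j hx)
  refine ⟨hK, ?_⟩
  have hqr : (SdS.map q).app k d' = r := by
    apply SdS_map_app_injective e he
    rw [hr, ← SdS_map_comp_app, ← SdS_map_comp_app, hq]
  rw [← hqr, ← exApp_comp_app, ← exApp_comp_app]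
  simp only [hq]

lemma exApp_app_congr {m m' : SimplexCategory} {σ : m ⟶ n} {τ : m' ⟶ n}
    (h : stdSimplex.objEquiv.symm σ ∈ K.obj (op m))
    (h' : stdSimplex.objEquiv.symm τ ∈ K.obj (op m')) {k : SimplexCategoryᵒᵖ}
    (d : (nerve (sd m)).obj k) (d' : (nerve (sd m')).obj k)
    (hd : (SdS.map σ).app k d = (SdS.map τ).app k d') :
    (exApp u σ h).app k d = (exApp u τ h').app k d' := by
  obtain ⟨w, e, he, he'⟩ := exists_injective_hom_of_nonempty (top ((SdS.map σ).app k d))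
  obtain ⟨r, hr⟩ := exists_SdS_map_eq e ((SdS.map σ).app k d)
    fun j x hx ↦ (he' x).1 (le_top ((SdS.map σ).app k d) j hx)
  obtain ⟨_, h₁⟩ := exApp_app_eq u h d e he he' r hr
  obtain ⟨_, h₂⟩ := exApp_app_eq u h' d' e he (by rwa [← hd]) r (by rwa [← hd])
  rw [h₁, h₂]

/-- The transpose of a map `K ⟶ Ex X`, defined on the subdivision of `K`. -/
noncomputable def exTranspose : (sdSubcomplex K).toSSet ⟶ X where
  app k := ↾fun c ↦ (exApp u c.2.choose_spec.choose
    c.2.choose_spec.choose_spec.1).app k c.2.choose_spec.choose_spec.2.choose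
  naturality k k' β := by
    apply ConcreteCategory.hom_ext
    intro c
    refine Eq.trans ?_ (ConcreteCategory.congr_hom ((exApp u c.2.choose_spec.choose
      c.2.choose_spec.choose_spec.1).naturality β) c.2.choose_spec.choose_spec.2.choose)
    apply exApp_app_congr
    exact ((sdSubcomplex K).toSSet.map β c).2.choose_spec.choose_spec.2.choose_spec.trans
      (congrArg ((nerve (sd n)).map β) c.2.choose_spec.choose_spec.2.choose_spec.symm)

lemma exTranspose_app {m : SimplexCategory} (σ : m ⟶ n)
    (h : stdSimplex.objEquiv.symm σ ∈ K.obj (op m)) {k : SimplexCategoryᵒᵖ}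
    (d : (nerve (sd m)).obj k) :
    (exTranspose u).app k ⟨_, m, σ, h, d, rfl⟩ = (exApp u σ h).app k d :=
  have hc : (SdS.map σ).app k d ∈ (sdSubcomplex K).obj k := ⟨m, σ, h, d, rfl⟩
  exApp_app_congr u _ h _ d hc.choose_spec.choose_spec.2.choose_spec

end

lemma hasLiftingProperty_Ex_map {n : SimplexCategory} {K : (stdSimplex.{0}.obj n).Subcomplex}
    {X Y : SSet.{0}} {p : X ⟶ Y}
    (hK : ∀ (a : (sdSubcomplex K).toSSet ⟶ X) (b : nerve (sd n) ⟶ Y),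
      a ≫ p = (sdSubcomplex K).ι ≫ b →
      ∃ l : nerve (sd n) ⟶ X, (sdSubcomplex K).ι ≫ l = a ∧ l ≫ p = b) :
    HasLiftingProperty K.ι (Ex.map p) where
  sq_hasLift {u v} sq := by
    let b : nerve (sd n) ⟶ Y := SSet.yonedaEquiv v
    have hb {m : SimplexCategory} (σ : m ⟶ n) :
        (show nerve (sd m) ⟶ Y from v.app (op m) (stdSimplex.objEquiv.symm σ)) =
          SdS.map σ ≫ b := by
      have := congrArg (fun t ↦ t.app (op m) (stdSimplex.objEquiv.symm σ))
        (SSet.yonedaEquiv.symm_apply_apply v).symm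
      exact this
    obtain ⟨l, hl, hl'⟩ := hK (exTranspose u) b (by
      ext k ⟨_, m, σ, h, d, rfl⟩
      refine (congrArg (p.app k) (exTranspose_app u σ h d)).trans ?_
      have h₁ : exApp u σ h ≫ p = SdS.map σ ≫ b := by
        rw [← hb]
        exact ConcreteCategory.congr_hom (NatTrans.congr_app sq.w (op m)) ⟨_, h⟩
      exact ConcreteCategory.congr_hom (NatTrans.congr_app h₁ k) d)
    let L : stdSimplex.obj n ⟶ Ex.obj X := SSet.yonedaEquiv.symm l
    have hL : SSet.yonedaEquiv L = l := Equiv.apply_symm_apply _ _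
    refine ⟨⟨L, ?_, ?_⟩⟩
    · ext ⟨m⟩ ⟨x, h⟩
      obtain ⟨σ, rfl⟩ := stdSimplex.objEquiv.symm.surjective x
      have : SdS.map σ ≫ l = exApp u σ h := by
        ext k d
        refine Eq.trans ?_ (exTranspose_app u σ h d)
        exact ConcreteCategory.congr_hom (NatTrans.congr_app hl k)
          ⟨(SdS.map σ).app k d, m, σ, h, d, rfl⟩
      exact this
    · apply SSet.yonedaEquiv.injective
      refine Eq.trans ?_ hl'
      exact congrArg (· ≫ p) hL

lemma mem_sdSubcomplex_horn_iff {n : ℕ} {i : Fin (n + 1)} {k : SimplexCategoryᵒᵖ}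
    (c : (nerve (sd ⦋n⦌)).obj k) :
    c ∈ (sdSubcomplex (horn n i)).obj k ↔
      ∃ T : Finset (Fin (n + 1)), insert i T ≠ Finset.univ ∧ ∀ j, (c.obj j).1 ⊆ T := by
  constructor
  · rintro ⟨m, σ, hσ, d, rfl⟩
    refine ⟨Finset.univ.image σ.toOrderHom, fun h ↦ ?_,
      fun j ↦ Finset.image_subset_image (Finset.subset_univ _)⟩
    rw [mem_horn_iff] at hσ
    refine hσ (Set.eq_univ_of_forall fun x ↦ ?_)
    obtain rfl | hx := Finset.mem_insert.1 (h ▸ Finset.mem_univ x)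
    · exact Or.inr rfl
    · obtain ⟨y, -, hy⟩ := Finset.mem_image.1 hx
      exact Or.inl ⟨y, hy⟩
  · rintro ⟨T, hT, hc⟩
    obtain ⟨w, e, -, he⟩ := exists_injective_hom_of_nonempty (n := ⦋n⦌)
      ⟨insert i T, Finset.insert_nonempty i T⟩
    obtain ⟨r, rfl⟩ := exists_SdS_map_eq e c
      fun j x hx ↦ (he x).1 (Finset.mem_insert_of_mem (hc j hx))
    refine ⟨w, e, ?_, r, rfl⟩
    rw [mem_horn_iff]
    intro h
    refine hT (Finset.eq_univ_of_forall fun x ↦ ?_)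
    obtain ⟨y, hy⟩ | hx := h ▸ Set.mem_univ x
    · exact (he x).2 ⟨y, hy⟩
    · rw [Set.mem_singleton_iff.1 hx]
      exact Finset.mem_insert_self _ _

/-- The monotone map adjoining the element `i` to a subset. -/
def adjoin {n : ℕ} (i : Fin (n + 1)) : sd ⦋n⦌ →o sd ⦋n⦌ where
  toFun S := ⟨insert i S.1, Finset.insert_nonempty i _⟩
  monotone' _ _ h := Finset.insert_subset_insert i h

/-- The constant monotone map at the vertex `i`. -/
def vertex {n : ℕ} (i : Fin (n + 1)) : sd ⦋n⦌ →o sd ⦋n⦌ where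
  toFun _ := ⟨{i}, Finset.singleton_nonempty i⟩
  monotone' _ _ _ := le_rfl

/-- The monotone map on `P × {0 < 1}` given by comparable monotone maps. -/
def homotopyOfLE {P : Type} [Preorder P] {s t : P →o P} (hst : s ≤ t) : P × Fin 2 →o P where
  toFun x := if x.2 = 0 then s x.1 else t x.1
  monotone' x y hxy := by
    obtain ⟨x, a⟩ := x
    obtain ⟨y, b⟩ := y
    obtain ⟨h, hab⟩ : x ≤ y ∧ a ≤ b := hxy
    dsimp only
    split_ifs with ha hb hb
    · exact s.monotone h
    · exact (s.monotone h).trans (hst y)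
    · subst hb
      exact (ha (le_antisymm hab (Fin.zero_le _))).elim
    · exact t.monotone h

lemma KanFibration.exists_lift_sdSubcomplex_horn {X Y : SSet.{0}} {p : X ⟶ Y}
    (hp : KanFibration p) {n : ℕ} (i : Fin (n + 2))
    (a : (sdSubcomplex (horn (n + 1) i)).toSSet ⟶ X) (b : nerve (sd ⦋n + 1⦌) ⟶ Y)
    (hab : a ≫ p = (sdSubcomplex (horn (n + 1) i)).ι ≫ b) :
    ∃ l : nerve (sd ⦋n + 1⦌) ⟶ X, (sdSubcomplex (horn (n + 1) i)).ι ≫ l = a ∧ l ≫ p = b := by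
  have stable {s : sd ⦋n + 1⦌ →o sd ⦋n + 1⦌} (hs : s ≤ adjoin i) (m : SimplexCategoryᵒᵖ)
      (x : (nerve (sd ⦋n + 1⦌) ⊗ Δ[1]).obj m)
      (hx : x.1 ∈ (sdSubcomplex (horn (n + 1) i)).obj m) :
      (nerveHomotopy (homotopyOfLE hs)).app m x ∈ (sdSubcomplex (horn (n + 1) i)).obj m := by
    obtain ⟨T, hT, hT'⟩ := (mem_sdSubcomplex_horn_iff _).1 hx
    refine (mem_sdSubcomplex_horn_iff _).2 ⟨insert i T, by rwa [Finset.insert_idem], fun j ↦ ?_⟩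
    have h₁ : (adjoin i (x.1.obj j)).1 ⊆ insert i T := Finset.insert_subset_insert i (hT' j)
    change (if stdSimplex.asOrderHom x.2 j = 0 then s (x.1.obj j)
      else adjoin i (x.1.obj j)).1 ⊆ insert i T
    split_ifs
    · exact Finset.Subset.trans (hs (x.1.obj j)) h₁
    · exact h₁
  have hv : vertex i ≤ adjoin i := fun S ↦
    Finset.singleton_subset_iff.2 (Finset.mem_insert_self i S.1)
  have hid : OrderHom.id ≤ adjoin i := fun S ↦ Finset.subset_insert i S.1
  have vertex_mem (m : SimplexCategoryᵒᵖ) (c : (nerve (sd ⦋n + 1⦌)).obj m) :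
      (nerveEnd (vertex i)).app m c ∈ (sdSubcomplex (horn (n + 1) i)).obj m := by
    refine (mem_sdSubcomplex_horn_iff _).2 ⟨{i}, fun h ↦ ?_, fun j ↦ subset_rfl⟩
    have := congrArg Finset.card h
    simp at this
  have h₀ : HasLiftAlong p a b (vertex i) :=
    ⟨Subcomplex.lift (nerveEnd (vertex i)) (by
      rintro m _ ⟨c, rfl⟩
      exact vertex_mem m c) ≫ a, by rw [Category.assoc, hab]; rfl,
      fun m c _ ↦ ⟨vertex_mem m c, rfl⟩⟩
  have h₁ : HasLiftAlong p a b (adjoin i) :=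
    HasLiftAlong.of_homotopy hp hab (homotopyOfLE hv) (stable hv) (k := 0) h₀ 1
  obtain ⟨l, hl, hl'⟩ : HasLiftAlong p a b OrderHom.id :=
    HasLiftAlong.of_homotopy hp hab (homotopyOfLE hid) (stable hid) (k := 1) h₁ 0
  refine ⟨l, ?_, hl⟩
  ext m c
  obtain ⟨_, h⟩ := hl' m _ c.2
  exact h

end Paper

/-- The functor `Ex` preserves Kan fibrations and trivial
fibrations. -/
theorem Ex_preserves_fibrations {X Y : SSet.{0}} (p : X ⟶ Y) :
    (Paper.KanFibration p → Paper.KanFibration (Paper.Ex.map p)) ∧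
    (Paper.TrivialFibration p → Paper.TrivialFibration (Paper.Ex.map p)) := by
  refine ⟨fun hp n i ↦ Paper.hasLiftingProperty_Ex_map
    (hp.exists_lift_sdSubcomplex_horn i), fun hp n ↦ Paper.hasLiftingProperty_Ex_map ?_⟩
  intro a b hab
  have := hp.rlp_monomorphisms (Paper.sdSubcomplex (boundary n)).ι
    (MorphismProperty.monomorphisms.infer_property _)
  have sq : CommSq a (Paper.sdSubcomplex (boundary n)).ι p b := ⟨hab⟩
  exact ⟨sq.lift, sq.fac_left, sq.fac_right⟩
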